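/- For an involutory knot-theoretic ternary quasigroup (IKTQ) X and every n: ∂_n(C_n^{ID}(X)) ⊆ C_{n-1}^{ID}(X), where ∂_n = ∂_n^L - ∂_n^R. Hence (C_n^{ID}(X), ∂_n) is a chain subcomplex of (C_n(X), ∂_n). -/

import Mathlib

variable {X : Type*}

/-- The reversed operation `T̂`, with `xyzT̂ = zyxT`. -/
def hatOp (S : X → X → X → X) : X → X → X → X := fun x y z => S z y x

/-- Extend an `(n+2)`-tuple `x = (x_0, …, x_{n+1})` to a function on `ℕ`
(values beyond index `n+1` are irrelevant junk). -/
def ext (n : ℕ) (x : Fin (n + 2) → X) : ℕ → X :=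
  fun m => if h : m < n + 2 then x ⟨m, h⟩ else x 0

/-- Coordinate description of the left face maps: `d_{i,k}^{L}` is `x_k` for
`k > i` and `x_{k-1}x_k(d_{i,k+1}^{L}x)T` for `k ≤ i` (computed right to left). -/
def dLcoord (T : X → X → X → X) (i : ℕ) (x : ℕ → X) (k : ℕ) : X :=
  if h : i < k then x k
  else T (x (k - 1)) (x k) (dLcoord T i x (k + 1))
termination_by i + 1 - k
decreasing_by omega

/-- Coordinate description of the right face maps: `d_{i,k}^{R}` is `x_k` for
`k ≤ i` and `(d_{i,k-1}^{R}x)x_kx_{k+1}T` for `k > i` (computed left to right). -/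
def dRcoord (T : X → X → X → X) (i : ℕ) (x : ℕ → X) (k : ℕ) : X :=
  if h : k ≤ i then x k
  else T (dRcoord T i x (k - 1)) (x k) (x (k + 1))
termination_by k
decreasing_by omega

/-- Inductive description of the left face maps:
`d_0^{L}x = (x_1, …, x_{n+1})` and
`d_i^{L}x = d_{i-1}^{L}(x  with  x_i ↦ x_{i-1}x_ix_{i+1}T)`.
The result is indexed so that entry `k` is the `(k+1)`-st coordinate. -/
def dLind (T : X → X → X → X) : ℕ → (ℕ → X) → ℕ → X
  | 0, x, k => x (k + 1)
  | i + 1, x, k =>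
      dLind T i (fun m => if m = i + 1 then T (x i) (x (i + 1)) (x (i + 2)) else x m) k

/-- The left face map `d_i^{n,L}` (coordinate description), as a map from
`(n+2)`-tuples to `(n+1)`-tuples; entry `p` is the coordinate `d_{i,p+1}^{n,L}`. -/
def dL (T : X → X → X → X) (n i : ℕ) (x : Fin (n + 2) → X) : Fin (n + 1) → X :=
  fun p => dLcoord T i (ext n x) (p.1 + 1)

/-- The left face map `d_i^{n,L}` (inductive description). -/
def dLInd (T : X → X → X → X) (n i : ℕ) (x : Fin (n + 2) → X) : Fin (n + 1) → X :=
  fun p => dLind T i (ext n x) p.1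

/-- The right face map `d_i^{n,R}`; entry `p` is the coordinate `d_{i,p}^{n,R}`. -/
def dR (T : X → X → X → X) (n i : ℕ) (x : Fin (n + 2) → X) : Fin (n + 1) → X :=
  fun p => dRcoord T i (ext n x) p.1

/-- The boundary homomorphism `∂_{n}^{L} = Σ_{i=0}^{n} (-1)^i d_i^{n,L}`
on the free abelian group on `(n+2)`-tuples (used for `n ≥ 1`). -/
def boundaryL (T : X → X → X → X) (n : ℕ) :
    FreeAbelianGroup (Fin (n + 2) → X) →+ FreeAbelianGroup (Fin (n + 1) → X) :=
  FreeAbelianGroup.lift fun x =>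
    ∑ i ∈ Finset.range (n + 1), ((-1 : ℤ) ^ i) • FreeAbelianGroup.of (dL T n i x)

/-- The boundary homomorphism `∂_{n}^{R} = Σ_{i=0}^{n} (-1)^i d_i^{n,R}`. -/
def boundaryR (T : X → X → X → X) (n : ℕ) :
    FreeAbelianGroup (Fin (n + 2) → X) →+ FreeAbelianGroup (Fin (n + 1) → X) :=
  FreeAbelianGroup.lift fun x =>
    ∑ i ∈ Finset.range (n + 1), ((-1 : ℤ) ^ i) • FreeAbelianGroup.of (dR T n i x)

/-- The boundary homomorphism `∂_n = ∂_n^L - ∂_n^R`. -/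
def boundary (T : X → X → X → X) (n : ℕ) :
    FreeAbelianGroup (Fin (n + 2) → X) →+ FreeAbelianGroup (Fin (n + 1) → X) :=
  boundaryL T n - boundaryR T n

/-- An `(m+2)`-tuple is degenerate if it contains, on three consecutive
coordinates, a triple `(a, b, abbR)` (condition D1) or `(bbaL, b, a)`
(condition D2). -/
def IsDegenerate (L R : X → X → X → X) (m : ℕ) (x : Fin (m + 2) → X) : Prop :=
  ∃ (j : ℕ) (h : j + 2 < m + 2) (a b : X),
    (x ⟨j, by omega⟩ = a ∧ x ⟨j + 1, by omega⟩ = b ∧ x ⟨j + 2, h⟩ = R a b b) ∨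
    (x ⟨j, by omega⟩ = L b b a ∧ x ⟨j + 1, by omega⟩ = b ∧ x ⟨j + 2, h⟩ = a)

/-- `C_m^D(X)`: the subgroup of `C_m(X)` generated by the degenerate tuples. -/
def CD (L R : X → X → X → X) (m : ℕ) :
    AddSubgroup (FreeAbelianGroup (Fin (m + 2) → X)) :=
  AddSubgroup.closure {c | ∃ x, IsDegenerate L R m x ∧ c = FreeAbelianGroup.of x}

/-- `x[j]`: the tuple obtained from `x` by replacing `x_j` with `x_{j-1}x_jx_{j+1}T`. -/
def tupleSub (T : X → X → X → X) (m : ℕ) (x : Fin (m + 2) → X) (j : ℕ)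
    (h1 : 1 ≤ j) (h2 : j ≤ m) : Fin (m + 2) → X :=
  Function.update x ⟨j, by omega⟩
    (T (x ⟨j - 1, by omega⟩) (x ⟨j, by omega⟩) (x ⟨j + 1, by omega⟩))

/-- `C_m^I(X)`: the subgroup of `C_m(X)` generated by the sums `x + x[j]`,
`1 ≤ j ≤ m`. -/
def CI (T : X → X → X → X) (m : ℕ) :
    AddSubgroup (FreeAbelianGroup (Fin (m + 2) → X)) :=
  AddSubgroup.closure {c | ∃ (x : Fin (m + 2) → X) (j : ℕ) (h1 : 1 ≤ j) (h2 : j ≤ m),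
    c = FreeAbelianGroup.of x + FreeAbelianGroup.of (tupleSub T m x j h1 h2)}

/-- `C_m^{ID}(X)`: the subgroup of `C_m(X)` generated by the sums `x + x[j]`
together with the degenerate tuples. -/
def CID (T L R : X → X → X → X) (m : ℕ) :
    AddSubgroup (FreeAbelianGroup (Fin (m + 2) → X)) :=
  AddSubgroup.closure
    ({c | ∃ (x : Fin (m + 2) → X) (j : ℕ) (h1 : 1 ≤ j) (h2 : j ≤ m),
        c = FreeAbelianGroup.of x + FreeAbelianGroup.of (tupleSub T m x j h1 h2)} ∪
      {c | ∃ x, IsDegenerate L R m x ∧ c = FreeAbelianGroup.of x})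

/-- Reversal of a tuple. -/
def revTuple {m : ℕ} (x : Fin m → X) : Fin m → X := fun k => x k.rev

/-- `x[j]` for sequences indexed by `ℕ`. -/
def seqSub (T : X → X → X → X) (x : ℕ → X) (j : ℕ) : ℕ → X :=
  fun m => if m = j then T (x (j - 1)) (x j) (x (j + 1)) else x m

lemma seqSub_self (T : X → X → X → X) (x : ℕ → X) (j : ℕ) :
    seqSub T x j j = T (x (j - 1)) (x j) (x (j + 1)) := by
  simp [seqSub]

lemma seqSub_of_ne (T : X → X → X → X) (x : ℕ → X) {j m : ℕ} (h : m ≠ j) :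
    seqSub T x j m = x m := by
  simp [seqSub, h]

lemma seqSub_seqSub (T : X → X → X → X)
    (hinv : ∀ x1 x2 x3 : X, T x1 (T x1 x2 x3) x3 = x2) (x : ℕ → X) {j : ℕ} (hj : 1 ≤ j) :
    seqSub T (seqSub T x j) j = x := by
  funext m
  by_cases h : m = j
  · subst h
    rw [seqSub_self, seqSub_self, seqSub_of_ne T x (by omega : m - 1 ≠ m),
      seqSub_of_ne T x (by omega : m + 1 ≠ m), hinv]
  · rw [seqSub_of_ne _ _ h, seqSub_of_ne _ _ h]

lemma ext_tupleSub (T : X → X → X → X) (m : ℕ) (x : Fin (m + 2) → X) (j : ℕ)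
    (h1 : 1 ≤ j) (h2 : j ≤ m) :
    ext m (tupleSub T m x j h1 h2) = seqSub T (ext m x) j := by
  funext k
  by_cases hk : k = j
  · subst hk
    rw [seqSub_self]
    simp [ext, tupleSub, show k < m + 2 by omega, show k - 1 < m + 2 by omega, h2]
  · rw [seqSub_of_ne _ _ hk]
    have h0 : (0 : Fin (m + 2)) ≠ ⟨j, by omega⟩ := by
      simp only [ne_eq, Fin.ext_iff, Fin.val_zero]
      omega
    by_cases hm : k < m + 2
    · simp [ext, tupleSub, hm, Fin.ext_iff, hk]
    · simp [ext, tupleSub, hm, Function.update_of_ne h0]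

lemma dLcoord_of_lt (T : X → X → X → X) (x : ℕ → X) {i k : ℕ} (h : i < k) :
    dLcoord T i x k = x k := by
  rw [dLcoord, dif_pos h]

lemma dLcoord_of_le (T : X → X → X → X) (x : ℕ → X) {i k : ℕ} (h : k ≤ i) :
    dLcoord T i x k = T (x (k - 1)) (x k) (dLcoord T i x (k + 1)) := by
  rw [dLcoord, dif_neg (by omega)]

lemma dRcoord_of_le (T : X → X → X → X) (x : ℕ → X) {i k : ℕ} (h : k ≤ i) :
    dRcoord T i x k = x k := by
  rw [dRcoord, dif_pos h]

lemma dRcoord_of_lt (T : X → X → X → X) (x : ℕ → X) {i k : ℕ} (h : i < k) :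
    dRcoord T i x k = T (dRcoord T i x (k - 1)) (x k) (x (k + 1)) := by
  rw [dRcoord, dif_neg (by omega)]

/-- A left face taken two or more places before `j` commutes with the substitution at `j`. -/
lemma dLcoord_seqSub_of_lt (T : X → X → X → X) (x : ℕ → X) {i j : ℕ} (hij : i + 1 < j) (p : ℕ) :
    dLcoord T i (seqSub T x j) p = seqSub T (dLcoord T i x) j p := by
  by_cases hp : i < p
  · rw [dLcoord_of_lt _ _ hp]
    by_cases h : p = j
    · subst h
      rw [seqSub_self, seqSub_self, dLcoord_of_lt _ _ hp, dLcoord_of_lt _ _ (by omega),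
        dLcoord_of_lt _ _ (by omega)]
    · rw [seqSub_of_ne _ _ h, seqSub_of_ne _ _ h, dLcoord_of_lt _ _ hp]
  · rw [seqSub_of_ne _ _ (by omega), dLcoord_of_le _ _ (by omega : p ≤ i),
      dLcoord_of_le _ _ (by omega : p ≤ i), dLcoord_seqSub_of_lt T x hij (p + 1),
      seqSub_of_ne _ _ (by omega), seqSub_of_ne _ _ (by omega), seqSub_of_ne _ _ (by omega)]
termination_by i + 1 - p

/-- A left face taken after `j` turns the substitution at `j` into one at `j + 1`. -/
lemma dLcoord_seqSub_of_gt (T : X → X → X → X)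
    (hA3L : ∀ a b c d : X, T (T a b c) c d = T (T a b (T b c d)) (T b c d) d)
    (hA3R : ∀ a b c d : X, T a b (T b c d) = T a (T a b c) (T (T a b c) c d))
    (x : ℕ → X) {i j : ℕ} (hj : 1 ≤ j) (hij : j < i) (p : ℕ) (hp : 1 ≤ p) :
    dLcoord T i (seqSub T x j) p = seqSub T (dLcoord T i x) (j + 1) p := by
  by_cases hpi : i < p
  · rw [dLcoord_of_lt _ _ hpi, seqSub_of_ne _ _ (by omega), seqSub_of_ne _ _ (by omega),
      dLcoord_of_lt _ _ hpi]
  have ih := dLcoord_seqSub_of_gt T hA3L hA3R x hj hij (p + 1) (by omega)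
  rw [dLcoord_of_le _ _ (by omega : p ≤ i), ih]
  have hyj : dLcoord T i x j = _ := dLcoord_of_le T x (by omega : j ≤ i)
  have hyj' : dLcoord T i x (j + 1) = _ := dLcoord_of_le T x (by omega : j + 1 ≤ i)
  simp only [Nat.add_sub_cancel] at hyj'
  by_cases h : p = j
  · subst h
    rw [seqSub_self, seqSub_self, seqSub_of_ne _ _ (by omega), seqSub_of_ne _ _ (by omega),
      Nat.add_sub_cancel, hyj, hyj', ← hA3L, ← hA3R]
  by_cases h' : p = j + 1
  · subst h'
    rw [seqSub_self, Nat.add_sub_cancel, seqSub_self, seqSub_of_ne _ _ (by omega),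
      seqSub_of_ne _ _ (by omega), hyj, hyj', ← hA3L]
  · rw [seqSub_of_ne _ _ (by omega), seqSub_of_ne _ _ (by omega), seqSub_of_ne _ _ (by omega),
      seqSub_of_ne _ _ (by omega), ← dLcoord_of_le T x (by omega : p ≤ i)]
termination_by i + 1 - p

lemma dLcoord_pred_seqSub (T : X → X → X → X) (x : ℕ → X) {j : ℕ} (hj : 1 ≤ j) (p : ℕ)
    (hp : 1 ≤ p) :
    dLcoord T (j - 1) (seqSub T x j) p = dLcoord T j x p := by
  by_cases hpj : j < p
  · rw [dLcoord_of_lt _ _ (by omega), dLcoord_of_lt _ _ hpj, seqSub_of_ne _ _ (by omega)]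
  by_cases h : p = j
  · subst h
    rw [dLcoord_of_lt _ _ (by omega), seqSub_self, dLcoord_of_le _ _ le_rfl,
      dLcoord_of_lt _ _ (by omega)]
  · rw [dLcoord_of_le _ _ (by omega : p ≤ j - 1), dLcoord_of_le _ _ (by omega : p ≤ j),
      dLcoord_pred_seqSub T x hj (p + 1) (by omega), seqSub_of_ne _ _ (by omega),
      seqSub_of_ne _ _ (by omega)]
termination_by j + 1 - p

/-- A right face taken after `j` commutes with the substitution at `j`. -/
lemma dRcoord_seqSub_of_gt (T : X → X → X → X) (x : ℕ → X) {i j : ℕ} (hij : j < i) (p : ℕ) :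
    dRcoord T i (seqSub T x j) p = seqSub T (dRcoord T i x) j p := by
  by_cases hp : p ≤ i
  · rw [dRcoord_of_le _ _ hp]
    by_cases h : p = j
    · subst h
      rw [seqSub_self, seqSub_self, dRcoord_of_le _ _ hp, dRcoord_of_le _ _ (by omega),
        dRcoord_of_le _ _ (by omega)]
    · rw [seqSub_of_ne _ _ h, seqSub_of_ne _ _ h, dRcoord_of_le _ _ hp]
  · rw [seqSub_of_ne _ _ (by omega), dRcoord_of_lt _ _ (by omega : i < p),
      dRcoord_of_lt _ _ (by omega : i < p), dRcoord_seqSub_of_gt T x hij (p - 1),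
      seqSub_of_ne _ _ (by omega), seqSub_of_ne _ _ (by omega), seqSub_of_ne _ _ (by omega)]
termination_by p

/-- A right face taken two or more places before `j` turns the substitution at `j` into one
at `j - 1`. -/
lemma dRcoord_seqSub_of_lt (T : X → X → X → X)
    (hA3L : ∀ a b c d : X, T (T a b c) c d = T (T a b (T b c d)) (T b c d) d)
    (hA3R : ∀ a b c d : X, T a b (T b c d) = T a (T a b c) (T (T a b c) c d))
    (x : ℕ → X) {i j : ℕ} (hij : i < j) (p : ℕ) :
    dRcoord T i (seqSub T x (j + 1)) p = seqSub T (dRcoord T i x) j p := by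
  by_cases hpi : p ≤ i
  · rw [dRcoord_of_le _ _ hpi, seqSub_of_ne _ _ (by omega), seqSub_of_ne _ _ (by omega),
      dRcoord_of_le _ _ hpi]
  have ih := dRcoord_seqSub_of_lt T hA3L hA3R x hij (p - 1)
  rw [dRcoord_of_lt _ _ (by omega : i < p), ih]
  have hyj : dRcoord T i x j = _ := dRcoord_of_lt T x (by omega : i < j)
  have hyj' : dRcoord T i x (j + 1) = _ := dRcoord_of_lt T x (by omega : i < j + 1)
  simp only [Nat.add_sub_cancel] at hyj'
  by_cases h : p = j
  · subst h
    rw [seqSub_self, seqSub_self, seqSub_of_ne _ _ (by omega), seqSub_of_ne _ _ (by omega),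
      Nat.add_sub_cancel, hyj', hyj, ← hA3R]
  by_cases h' : p = j + 1
  · subst h'
    rw [Nat.add_sub_cancel, seqSub_self, seqSub_self, Nat.add_sub_cancel,
      seqSub_of_ne _ _ (by omega), seqSub_of_ne _ _ (by omega), hyj', hyj, ← hA3R, ← hA3L]
  · rw [seqSub_of_ne _ _ (by omega), seqSub_of_ne _ _ (by omega), seqSub_of_ne _ _ (by omega),
      seqSub_of_ne _ _ (by omega), ← dRcoord_of_lt T x (by omega : i < p)]
termination_by p

lemma dRcoord_seqSub_self (T : X → X → X → X) (x : ℕ → X) {j : ℕ} (hj : 1 ≤ j) (p : ℕ) :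
    dRcoord T j (seqSub T x j) p = dRcoord T (j - 1) x p := by
  by_cases hpj : p < j
  · rw [dRcoord_of_le _ _ (by omega), dRcoord_of_le _ _ (by omega), seqSub_of_ne _ _ (by omega)]
  by_cases h : p = j
  · subst h
    rw [dRcoord_of_le _ _ le_rfl, seqSub_self, dRcoord_of_lt _ _ (by omega),
      dRcoord_of_le _ _ le_rfl]
  · rw [dRcoord_of_lt _ _ (by omega : j < p), dRcoord_of_lt _ _ (by omega : j - 1 < p),
      dRcoord_seqSub_self T x hj (p - 1), seqSub_of_ne _ _ (by omega),
      seqSub_of_ne _ _ (by omega)]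
termination_by p

/-- A tuple whose coordinates are those of a substituted sequence is a substituted tuple. -/
lemma eq_tupleSub_of_seqSub (T : X → X → X → X) (m s : ℕ) (y : ℕ → X) (z : Fin (m + 2) → X)
    (j : ℕ) (h1 : 1 ≤ j) (h2 : j ≤ m)
    (hz : ∀ p : Fin (m + 2), z p = seqSub T y (j + s) (p.1 + s)) :
    z = tupleSub T m (fun p => y (p.1 + s)) j h1 h2 := by
  funext p
  rw [hz]
  by_cases h : p.1 = j
  · obtain ⟨p, hp⟩ := p
    subst h
    rw [seqSub_self]
    simp only [tupleSub, Function.update_self]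
    have hp1 : 1 ≤ p := h1
    rw [show p + s - 1 = p - 1 + s by omega, show p + s + 1 = p + 1 + s by omega]
  · rw [seqSub_of_ne _ _ (by omega)]
    simp [tupleSub, Fin.ext_iff, h]

/-- How a family of faces `d i` of `(n+3)`-tuples interacts with the substitution at `j`: the faces
with indices `j - 1` and `j` are exchanged, and the others undergo a substitution. -/
structure FacesCompat (T : X → X → X → X) (n : ℕ)
    (d : ℕ → (Fin (n + 3) → X) → Fin (n + 2) → X)
    (x x' : Fin (n + 3) → X) (j : ℕ) : Prop where
  pred_sub : d (j - 1) x' = d j x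
  self_sub : d j x' = d (j - 1) x
  other : ∀ i < n + 2, i ≠ j - 1 → i ≠ j →
    ∃ (q : ℕ) (h1 : 1 ≤ q) (h2 : q ≤ n), d i x' = tupleSub T n (d i x) q h1 h2

lemma facesCompat_dL (T : X → X → X → X)
    (hinv : ∀ x1 x2 x3 : X, T x1 (T x1 x2 x3) x3 = x2)
    (hA3L : ∀ a b c d : X, T (T a b c) c d = T (T a b (T b c d)) (T b c d) d)
    (hA3R : ∀ a b c d : X, T a b (T b c d) = T a (T a b c) (T (T a b c) c d))
    (n : ℕ) (x : Fin (n + 3) → X) (j : ℕ) (h1 : 1 ≤ j) (h2 : j ≤ n + 1) :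
    FacesCompat T n (dL T (n + 1)) x (tupleSub T (n + 1) x j h1 h2) j where
  pred_sub := by
    funext p
    simp only [dL, ext_tupleSub]
    exact dLcoord_pred_seqSub T _ h1 _ (by omega)
  self_sub := by
    funext p
    simp only [dL, ext_tupleSub]
    rw [← dLcoord_pred_seqSub T _ h1 _ (by omega), seqSub_seqSub T hinv _ h1]
  other := by
    intro i hi hne hne'
    rcases Nat.lt_or_ge i j with hij | hij
    · refine ⟨j - 1, by omega, by omega, ?_⟩
      refine eq_tupleSub_of_seqSub T n 1 _ _ (j - 1) _ _ fun p => ?_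
      rw [Nat.sub_add_cancel h1]
      simp only [dL, ext_tupleSub]
      exact dLcoord_seqSub_of_lt T _ (by omega) _
    · refine ⟨j, by omega, by omega, ?_⟩
      refine eq_tupleSub_of_seqSub T n 1 _ _ j _ _ fun p => ?_
      simp only [dL, ext_tupleSub]
      exact dLcoord_seqSub_of_gt T hA3L hA3R _ h1 (by omega) _ (by omega)

lemma facesCompat_dR (T : X → X → X → X)
    (hinv : ∀ x1 x2 x3 : X, T x1 (T x1 x2 x3) x3 = x2)
    (hA3L : ∀ a b c d : X, T (T a b c) c d = T (T a b (T b c d)) (T b c d) d)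
    (hA3R : ∀ a b c d : X, T a b (T b c d) = T a (T a b c) (T (T a b c) c d))
    (n : ℕ) (x : Fin (n + 3) → X) (j : ℕ) (h1 : 1 ≤ j) (h2 : j ≤ n + 1) :
    FacesCompat T n (dR T (n + 1)) x (tupleSub T (n + 1) x j h1 h2) j where
  pred_sub := by
    funext p
    simp only [dR, ext_tupleSub]
    rw [← dRcoord_seqSub_self T _ h1, seqSub_seqSub T hinv _ h1]
  self_sub := by
    funext p
    simp only [dR, ext_tupleSub]
    exact dRcoord_seqSub_self T _ h1 _
  other := by
    intro i hi hne hne'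
    rcases Nat.lt_or_ge i j with hij | hij
    · refine ⟨j - 1, by omega, by omega, ?_⟩
      refine eq_tupleSub_of_seqSub T n 0 _ _ (j - 1) _ _ fun p => ?_
      simp only [dR, ext_tupleSub, Nat.add_zero]
      have h := dRcoord_seqSub_of_lt T hA3L hA3R (ext (n + 1) x) (by omega : i < j - 1) p.1
      rwa [Nat.sub_add_cancel h1] at h
    · refine ⟨j, by omega, by omega, ?_⟩
      refine eq_tupleSub_of_seqSub T n 0 _ _ j _ _ fun p => ?_
      simp only [dR, ext_tupleSub, Nat.add_zero]
      exact dRcoord_seqSub_of_gt T _ (by omega) _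

/-- An alternating sum lies in a subgroup if two consecutive terms agree and all the others lie in
the subgroup. -/
lemma alternating_sum_mem {A : Type*} [AddCommGroup A] (S : AddSubgroup A) (g : ℕ → A) (N j : ℕ)
    (h1 : 1 ≤ j) (h2 : j < N) (heq : g (j - 1) = g j)
    (hmem : ∀ i < N, i ≠ j - 1 → i ≠ j → g i ∈ S) :
    ∑ i ∈ Finset.range N, ((-1 : ℤ) ^ i) • g i ∈ S := by
  obtain ⟨k, rfl⟩ : ∃ k, j = k + 1 := ⟨j - 1, by omega⟩
  simp only [Nat.add_sub_cancel] at heq hmem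
  have hk : k ∈ Finset.range N := Finset.mem_range.2 (by omega)
  have hk' : k + 1 ∈ (Finset.range N).erase k := by simp [h2]
  rw [← Finset.add_sum_erase _ _ hk, ← Finset.add_sum_erase _ _ hk', ← add_assoc, ← heq, pow_succ,
    mul_neg_one, neg_smul, add_neg_cancel, zero_add]
  refine S.sum_mem fun i hi => S.zsmul_mem ?_ _
  simp only [Finset.mem_erase, Finset.mem_range] at hi
  exact hmem i hi.2.2 hi.2.1 hi.1

lemma isDegenerate_of_tupleSub_eq {T L R : X → X → X → X}
    (hq5 : ∀ x1 x2 x3 : X, R x1 x2 (T x1 x2 x3) = x3)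
    {m : ℕ} {x : Fin (m + 2) → X} {j : ℕ} {h1 : 1 ≤ j} {h2 : j ≤ m}
    (h : tupleSub T m x j h1 h2 = x) : IsDegenerate L R m x := by
  obtain ⟨k, rfl⟩ : ∃ k, j = k + 1 := ⟨j - 1, by omega⟩
  have hk := congrFun h ⟨k + 1, by omega⟩
  simp only [tupleSub, Function.update_self, Nat.add_sub_cancel] at hk
  refine ⟨k, by omega, _, _, Or.inl ⟨rfl, rfl, ?_⟩⟩
  conv_rhs => arg 3; rw [← hk]
  rw [hq5]

lemma exists_tupleSub_eq_of_isDegenerate {T L R : X → X → X → X}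
    (hq2 : ∀ x1 x2 x3 : X, T (L x1 x2 x3) x2 x3 = x1)
    (hq6 : ∀ x1 x2 x3 : X, T x1 x2 (R x1 x2 x3) = x3)
    {m : ℕ} {x : Fin (m + 2) → X} (h : IsDegenerate L R m x) :
    ∃ (j : ℕ) (h1 : 1 ≤ j) (h2 : j ≤ m), tupleSub T m x j h1 h2 = x := by
  obtain ⟨k, hk, a, b, h⟩ := h
  refine ⟨k + 1, by omega, by omega, ?_⟩
  rw [tupleSub, Function.update_eq_self_iff]
  rcases h with ⟨ha, hb, hc⟩ | ⟨ha, hb, hc⟩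
  · simp only [Nat.add_sub_cancel]
    rw [ha, hb, hc, hq6]
  · simp only [Nat.add_sub_cancel]
    rw [ha, hb, hc, hq2]

lemma FacesCompat.sum_add_mem {T : X → X → X → X} (L R : X → X → X → X) {n : ℕ}
    {d : ℕ → (Fin (n + 3) → X) → Fin (n + 2) → X} {x x' : Fin (n + 3) → X} {j : ℕ}
    (hd : FacesCompat T n d x x' j) (h1 : 1 ≤ j) (h2 : j ≤ n + 1) :
    ∑ i ∈ Finset.range (n + 2), ((-1 : ℤ) ^ i) • FreeAbelianGroup.of (d i x) +
      ∑ i ∈ Finset.range (n + 2), ((-1 : ℤ) ^ i) • FreeAbelianGroup.of (d i x') ∈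
        CID T L R n := by
  simp only [← Finset.sum_add_distrib, ← smul_add]
  refine alternating_sum_mem _ _ _ j h1 (by omega) ?_ fun i hi hne hne' => ?_
  · rw [hd.pred_sub, hd.self_sub]
    exact add_comm _ _
  · obtain ⟨q, hq1, hq2, h⟩ := hd.other i hi hne hne'
    exact AddSubgroup.subset_closure (Or.inl ⟨_, q, hq1, hq2, by rw [h]⟩)

lemma FacesCompat.sum_mem {T L R : X → X → X → X}
    (hq5 : ∀ x1 x2 x3 : X, R x1 x2 (T x1 x2 x3) = x3) {n : ℕ}
    {d : ℕ → (Fin (n + 3) → X) → Fin (n + 2) → X} {x : Fin (n + 3) → X} {j : ℕ}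
    (hd : FacesCompat T n d x x j) (h1 : 1 ≤ j) (h2 : j ≤ n + 1) :
    ∑ i ∈ Finset.range (n + 2), ((-1 : ℤ) ^ i) • FreeAbelianGroup.of (d i x) ∈ CID T L R n := by
  refine alternating_sum_mem _ _ _ j h1 (by omega) ?_ fun i hi hne hne' => ?_
  · rw [hd.pred_sub]
  · obtain ⟨q, _, _, h⟩ := hd.other i hi hne hne'
    exact AddSubgroup.subset_closure
      (Or.inr ⟨_, isDegenerate_of_tupleSub_eq hq5 h.symm, rfl⟩)

/-- for an IKTQ `X` (a ternary quasigroup `(X,T,L,T,R)`, i.e.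
with `T = M`, satisfying A3L and A3R) and every `n`,
`∂_n(C_n^{ID}(X)) ⊆ C_{n-1}^{ID}(X)` where `∂_n = ∂_n^L - ∂_n^R`; hence
`(C_n^{ID}(X), ∂_n)` is a chain subcomplex of `(C_n(X), ∂_n)`. -/
theorem boundary_maps_CID_into_CID {X : Type*} (T L R : X → X → X → X)
    (hq1 : ∀ x1 x2 x3 : X, L (T x1 x2 x3) x2 x3 = x1)
    (hq2 : ∀ x1 x2 x3 : X, T (L x1 x2 x3) x2 x3 = x1)
    (hinv : ∀ x1 x2 x3 : X, T x1 (T x1 x2 x3) x3 = x2)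
    (hq5 : ∀ x1 x2 x3 : X, R x1 x2 (T x1 x2 x3) = x3)
    (hq6 : ∀ x1 x2 x3 : X, T x1 x2 (R x1 x2 x3) = x3)
    (hA3L : ∀ a b c d : X, T (T a b c) c d = T (T a b (T b c d)) (T b c d) d)
    (hA3R : ∀ a b c d : X, T a b (T b c d) = T a (T a b c) (T (T a b c) c d)) :
    ∀ n : ℕ, ∀ c ∈ CID T L R (n + 1), boundary T (n + 1) c ∈ CID T L R n := by
  intro n c hc
  induction hc using AddSubgroup.closure_induction with
  | zero => rw [map_zero]; exact zero_mem _
  | add a b _ _ ha hb => rw [map_add]; exact add_mem ha hb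
  | neg a _ ha => rw [map_neg]; exact neg_mem ha
  | mem c hc =>
    rcases hc with ⟨x, j, h1, h2, rfl⟩ | ⟨x, hx, rfl⟩
    · have hL := (facesCompat_dL T hinv hA3L hA3R n x j h1 h2).sum_add_mem L R h1 h2
      have hR := (facesCompat_dR T hinv hA3L hA3R n x j h1 h2).sum_add_mem L R h1 h2
      rw [boundary, AddMonoidHom.sub_apply, map_add, map_add, boundaryL, boundaryR]
      simp only [FreeAbelianGroup.lift_apply_of]
      exact sub_mem hL hR
    · obtain ⟨j, h1, h2, h⟩ := exists_tupleSub_eq_of_isDegenerate hq2 hq6 hx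
      have hL := facesCompat_dL T hinv hA3L hA3R n x j h1 h2
      have hR := facesCompat_dR T hinv hA3L hA3R n x j h1 h2
      rw [h] at hL hR
      rw [boundary, AddMonoidHom.sub_apply, boundaryL, boundaryR]
      simp only [FreeAbelianGroup.lift_apply_of]
      exact sub_mem (hL.sum_mem hq5 h1 h2) (hR.sum_mem hq5 h1 h2)
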